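/- arXiv:2501.02117 — 8 statements merged into one kernel-verified Lean document; each statement's English description precedes it below -/
import Mathlib

section
/- Fix m ≥ 1 and let P = I − D^{−1}L(q) be the reversible transition matrix on the friendship graph F_m. Assume the ratio condition: for each i = 1,…,m there is μ_i with μ_i = q_{0,2i−1}/π_{2i−1} = q_{0,2i}/π_{2i}. Define the star chain on vertices {0,1,…,m} by π̃_0 = π_0, π̃_i = π_{2i−1} + π_{2i}, q̃_{0,i} = q_{0,2i−1} + q_{0,2i} for i = 1,…,m, with D_S = diag(π̃_0,…,π̃_m), L_S the corresponding symmetric Laplacian on the star with edges {0,i}, and P_S = I − D_S^{−1}L_S. Let Λ be the (2m+1)×(m+1) matrix with Λ_{0,0} = 1, Λ_{2i−1,i} = Λ_{2i,i} = 1 for i = 1,…,m, and all other entries 0. Then P·Λ = Λ·P_S, and consequently every eigenvalue of P_S is an eigenvalue of P. -/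
open Matrix Polynomial

/-- The symmetric Laplacian `L(q)` of a weight function `q`:
off-diagonal entry `(i,j)` is `-q i j`, diagonal entry `(i,i)` is `∑_{k ≠ i} q i k`. -/
noncomputable def lap {n : ℕ} (q : Fin n → Fin n → ℝ) : Matrix (Fin n) (Fin n) ℝ :=
  Matrix.of fun i j => if i = j then ∑ k ∈ Finset.univ.erase i, q i k else -(q i j)

/-- The reversible transition matrix `P = I - D⁻¹ L(q)` with `D = diag(pr)`. -/
noncomputable def transP {n : ℕ} (pr : Fin n → ℝ) (q : Fin n → Fin n → ℝ) :
    Matrix (Fin n) (Fin n) ℝ :=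
  1 - (Matrix.diagonal pr)⁻¹ * lap q

/-- A (row-)stochastic matrix: nonnegative entries, each row summing to one. -/
def IsStochastic {n : ℕ} (M : Matrix (Fin n) (Fin n) ℝ) : Prop :=
  (∀ i j, 0 ≤ M i j) ∧ ∀ i, ∑ j, M i j = 1

/-- The second largest eigenvalue modulus: the supremum of `|lam|` over real
eigenvalues `lam` of `M` (roots of the characteristic polynomial, with
multiplicity), after removing one copy of the eigenvalue `1`. -/
noncomputable def slem {n : ℕ} (M : Matrix (Fin n) (Fin n) ℝ) : ℝ :=
  sSup {r : ℝ | ∃ lam ∈ (Matrix.charpoly M).roots.erase 1, r = |lam|}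

/-- Central vertex of the friendship graph `F_m`. -/
def v0 {m : ℕ} : Fin (2*m+1) := ⟨0, by omega⟩
/-- Vertex `2i-1` (first friend of blade `i`, with `i` running over `Fin m`). -/
def v1 {m : ℕ} (i : Fin m) : Fin (2*m+1) := ⟨2*(i:ℕ)+1, by have := i.isLt; omega⟩
/-- Vertex `2i` (second friend of blade `i`). -/
def v2 {m : ℕ} (i : Fin m) : Fin (2*m+1) := ⟨2*(i:ℕ)+2, by have := i.isLt; omega⟩

/-- Edge relation of the friendship graph `F_m`. -/
def IsEdge {m : ℕ} (a b : Fin (2*m+1)) : Prop :=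
  ∃ i : Fin m,
    ({a, b} : Set (Fin (2*m+1))) = {v0, v1 i} ∨
    ({a, b} : Set (Fin (2*m+1))) = {v0, v2 i} ∨
    ({a, b} : Set (Fin (2*m+1))) = {v1 i, v2 i}

/-- Central vertex of the star on `{0,…,m}`. -/
def sv0 {m : ℕ} : Fin (m+1) := 0
/-- Leaf `i` of the star (for `i` in `Fin m`). -/
def sv {m : ℕ} (i : Fin m) : Fin (m+1) := i.succ

/-- Edge relation of the star on `{0,…,m}` with edges `{0, i}`. -/
def IsStarEdge {m : ℕ} (a b : Fin (m+1)) : Prop :=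
  ∃ i : Fin m, ({a, b} : Set (Fin (m+1))) = {sv0, sv i}

/-- The Laplacian acts by weighted differences. -/
lemma lap_mulVec_apply {n : ℕ} (q : Fin n → Fin n → ℝ) (f : Fin n → ℝ) (i : Fin n) :
    (lap q *ᵥ f) i = ∑ k, q i k * (f i - f k) := by
  rw [← Finset.add_sum_erase _ _ (Finset.mem_univ i), Matrix.mulVec, dotProduct,
    ← Finset.add_sum_erase _ _ (Finset.mem_univ i)]
  simp only [lap, Matrix.of_apply, if_true, sub_self, mul_zero, zero_add, Finset.sum_mul,
    ← Finset.sum_add_distrib]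
  refine Finset.sum_congr rfl fun k hk => ?_
  rw [if_neg (Finset.ne_of_mem_erase hk).symm]
  ring

lemma transP_mulVec_apply {n : ℕ} {pr : Fin n → ℝ} (hpr : ∀ i, pr i ≠ 0)
    (q : Fin n → Fin n → ℝ) (f : Fin n → ℝ) (i : Fin n) :
    (transP pr q *ᵥ f) i = f i - (pr i)⁻¹ * ∑ k, q i k * (f i - f k) := by
  have hinv : (Matrix.diagonal pr)⁻¹ = Matrix.diagonal fun i => (pr i)⁻¹ := by
    refine Matrix.inv_eq_right_inv ?_
    rw [Matrix.diagonal_mul_diagonal, ← Matrix.diagonal_one]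
    congr 1
    funext j
    exact mul_inv_cancel₀ (hpr j)
  rw [transP, hinv, Matrix.sub_mulVec, Matrix.one_mulVec, ← Matrix.mulVec_mulVec, Pi.sub_apply,
    Matrix.mulVec_diagonal, lap_mulVec_apply]

/-- A sum over the vertices of `F_m`, split into the centre and the blades. -/
lemma sum_friendship {m : ℕ} (g : Fin (2*m+1) → ℝ) :
    ∑ k, g k = g v0 + ∑ i : Fin m, (g (v1 i) + g (v2 i)) := by
  induction m with
  | zero => simp [v0]
  | succ m ih =>
    rw [Fin.sum_univ_castSucc (n := m)]
    change ∑ k : Fin (2*m+1+1+1), g k = _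
    rw [Fin.sum_univ_castSucc, Fin.sum_univ_castSucc,
      ih fun k => g k.castSucc.castSucc, add_assoc, add_assoc]
    rfl

lemma friendship_cases {m : ℕ} (a : Fin (2*m+1)) :
    a = v0 ∨ ∃ i : Fin m, a = v1 i ∨ a = v2 i := by
  have ha := a.isLt
  rcases Nat.eq_zero_or_pos (a : ℕ) with h | h
  · exact Or.inl (Fin.ext h)
  · refine Or.inr ⟨⟨((a : ℕ) - 1) / 2, by omega⟩, ?_⟩
    simp only [Fin.ext_iff, v1, v2]
    omega

/-- Vertices in different blades are not adjacent. -/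
lemma not_isEdge_of_ne {m : ℕ} {i j : Fin m} (hij : i ≠ j) {a b : Fin (2*m+1)}
    (ha : a = v1 i ∨ a = v2 i) (hb : b = v1 j ∨ b = v2 j) : ¬ IsEdge a b := by
  rintro ⟨k, hk⟩
  simp only [Set.pair_eq_pair_iff, Fin.ext_iff, v0, v1, v2, ne_eq] at *
  omega

lemma not_isStarEdge_sv {m : ℕ} (i j : Fin m) : ¬ IsStarEdge (sv i) (sv j) := by
  rintro ⟨k, hk⟩
  simp only [Set.pair_eq_pair_iff, Fin.ext_iff, sv0, sv, Fin.val_succ, Fin.val_zero] at hk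
  omega

/-- The vertex of the star onto which a vertex of `F_m` is lumped. -/
def lump {m : ℕ} (a : Fin (2*m+1)) : Fin (m+1) := ⟨((a : ℕ) + 1) / 2, by omega⟩

lemma lump_v0 {m : ℕ} : lump (v0 : Fin (2*m+1)) = sv0 := by
  simp [lump, v0, sv0]

lemma lump_v1 {m : ℕ} (i : Fin m) : lump (v1 i) = sv i := by
  simp only [lump, v1, sv, Fin.ext_iff, Fin.val_succ]
  omega

lemma lump_v2 {m : ℕ} (i : Fin m) : lump (v2 i) = sv i := by
  simp only [lump, v2, sv, Fin.ext_iff, Fin.val_succ]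
  omega

lemma lump_surjective {m : ℕ} : Function.Surjective (lump (m := m)) := by
  intro b
  refine Fin.cases ⟨v0, lump_v0⟩ (fun i => ⟨v1 i, lump_v1 i⟩) b

/-- A blade vertex only sees the centre when the function is constant on blades. -/
lemma sum_blade {m : ℕ} {q : Fin (2*m+1) → Fin (2*m+1) → ℝ}
    (hedge : ∀ a b, ¬ IsEdge a b → q a b = 0) (f : Fin (m+1) → ℝ) {i : Fin m}
    {a : Fin (2*m+1)} (ha : a = v1 i ∨ a = v2 i) :
    ∑ k, q a k * (f (sv i) - f (lump k)) = q a v0 * (f (sv i) - f sv0) := by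
  rw [sum_friendship, Finset.sum_eq_zero, add_zero, lump_v0]
  intro j _
  rw [lump_v1, lump_v2]
  by_cases hij : i = j
  · simp [hij]
  · rw [hedge _ _ (not_isEdge_of_ne hij ha (.inl rfl)),
      hedge _ _ (not_isEdge_of_ne hij ha (.inr rfl))]
    simp

/-- Under the ratio condition, the friendship transition matrix `P`
and the associated star transition matrix `P_S` satisfy `P·Λ = Λ·P_S`, and every
eigenvalue of `P_S` is an eigenvalue of `P`. -/
theorem stmt_1 {m : ℕ} (hm : 1 ≤ m)
    (pr : Fin (2*m+1) → ℝ) (hpr : ∀ v, 0 < pr v)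
    (q : Fin (2*m+1) → Fin (2*m+1) → ℝ)
    (hsymm : ∀ a b, q a b = q b a)
    (hqnn : ∀ a b, 0 ≤ q a b)
    (hedge : ∀ a b, ¬ IsEdge a b → q a b = 0)
    (μ : Fin m → ℝ)
    (hratio : ∀ i : Fin m,
      μ i = q v0 (v1 i) / pr (v1 i) ∧ μ i = q v0 (v2 i) / pr (v2 i))
    (prS : Fin (m+1) → ℝ) (qS : Fin (m+1) → Fin (m+1) → ℝ)
    (hprS0 : prS sv0 = pr v0)
    (hprSi : ∀ i : Fin m, prS (sv i) = pr (v1 i) + pr (v2 i))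
    (hqSsymm : ∀ a b, qS a b = qS b a)
    (hqSe : ∀ i : Fin m, qS sv0 (sv i) = q v0 (v1 i) + q v0 (v2 i))
    (hqS0 : ∀ a b, ¬ IsStarEdge a b → qS a b = 0)
    (Λ : Matrix (Fin (2*m+1)) (Fin (m+1)) ℝ)
    (hΛ : ∀ a b, Λ a b = if (b : ℕ) = ((a : ℕ) + 1) / 2 then 1 else 0) :
    transP pr q * Λ = Λ * transP prS qS ∧
      ∀ lam : ℝ,
        (∃ v : Fin (m+1) → ℝ, v ≠ 0 ∧ (transP prS qS).mulVec v = lam • v) →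
        ∃ w : Fin (2*m+1) → ℝ, w ≠ 0 ∧ (transP pr q).mulVec w = lam • w := by
  have hne : ∀ v, pr v ≠ 0 := fun v => (hpr v).ne'
  have hneS : ∀ b, prS b ≠ 0 := by
    refine Fin.cases ?_ fun i => ?_
    · exact hprS0.trans_ne (hne v0)
    · exact (hprSi i).trans_ne (add_pos (hpr _) (hpr _)).ne'
  have hΛf (f : Fin (m+1) → ℝ) (a) : (Λ *ᵥ f) a = f (lump a) := by
    have hb (b : Fin (m+1)) : (b : ℕ) = ((a : ℕ) + 1) / 2 ↔ b = lump a := by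
      simp [Fin.ext_iff, lump]
    simp [Matrix.mulVec, dotProduct, hΛ, hb]
  have hq1 (i) : q v0 (v1 i) = μ i * pr (v1 i) := by
    rw [(hratio i).1, div_mul_cancel₀ _ (hne _)]
  have hq2 (i) : q v0 (v2 i) = μ i * pr (v2 i) := by
    rw [(hratio i).2, div_mul_cancel₀ _ (hne _)]
  have hleaf (f : Fin (m+1) → ℝ) (i : Fin m) :
      (transP prS qS *ᵥ f) (sv i) = f (sv i) - μ i * (f (sv i) - f sv0) := by
    have hsum : ∑ k, qS (sv i) k * (f (sv i) - f k) = qS (sv i) sv0 * (f (sv i) - f sv0) := by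
      rw [Fin.sum_univ_succ, Finset.sum_eq_zero, add_zero]
      · rfl
      · exact fun j _ => mul_eq_zero_of_left (hqS0 _ _ (not_isStarEdge_sv i j)) _
    have h := hneS (sv i)
    rw [transP_mulVec_apply hneS, hsum, hqSsymm, hqSe, hq1, hq2, ← mul_add, ← hprSi]
    field_simp
  have hblade (f : Fin (m+1) → ℝ) {i : Fin m} {a} (ha : a = v1 i ∨ a = v2 i)
      (hl : lump a = sv i) (hq : q v0 a = μ i * pr a) :
      (transP pr q *ᵥ (Λ *ᵥ f)) a = (Λ *ᵥ (transP prS qS *ᵥ f)) a := by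
    have h := hne a
    rw [hΛf, transP_mulVec_apply hne, hl, hleaf]
    simp only [hΛf]
    rw [hl, sum_blade hedge f ha, hsymm, hq]
    field_simp
  have hcomm (f : Fin (m+1) → ℝ) :
      transP pr q *ᵥ (Λ *ᵥ f) = Λ *ᵥ (transP prS qS *ᵥ f) := by
    funext a
    obtain rfl | ⟨i, rfl | rfl⟩ := friendship_cases a
    · rw [hΛf, transP_mulVec_apply hne, lump_v0, transP_mulVec_apply hneS, hprS0]
      simp only [hΛf]
      rw [sum_friendship, Fin.sum_univ_succ]
      change _ = f sv0 - _ * (qS sv0 sv0 * (f sv0 - f sv0) +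
        ∑ i : Fin m, qS sv0 (sv i) * (f sv0 - f (sv i)))
      simp only [lump_v0, lump_v1, lump_v2, hqSe, sub_self, mul_zero, add_mul]
    · exact hblade f (.inl rfl) (lump_v1 i) (hq1 i)
    · exact hblade f (.inr rfl) (lump_v2 i) (hq2 i)
  refine ⟨Matrix.ext_of_mulVec_single fun b => ?_, ?_⟩
  · rw [← Matrix.mulVec_mulVec, ← Matrix.mulVec_mulVec, hcomm]
  · rintro lam ⟨v, hv, hlam⟩
    refine ⟨Λ *ᵥ v, fun h => hv ?_, by rw [hcomm, hlam, Matrix.mulVec_smul]⟩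
    funext b
    obtain ⟨a, rfl⟩ := lump_surjective b
    rw [← hΛf v, h]
    rfl
end

section
/- Let m ≥ 1, let ϑ_1,…,ϑ_m and μ be real numbers, and let e_0,…,e_m be the standard basis of ℝ^{m+1}. Then the (m+1)×(m+1) real matrix M = I − μ·Σ_{i=1}^{m} (ϑ_i e_0 − e_i)(ϑ_i e_0 − e_i)ᵀ has characteristic polynomial (X − 1)·(X − (1−μ))^{m−1}·(X − (1 − μ(1 + Σ_{i=1}^{m} ϑ_i²))); i.e., its eigenvalues are 1 (with eigenvector (1, ϑ_1, …, ϑ_m)), 1−μ with multiplicity m−1, and 1 − μ(1 + Σ_{i=1}^{m} ϑ_i²). -/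
open Matrix Polynomial

/-- The matrix whose `i`-th column is `ϑ i • e₀ - e_{i+1}`. -/
def differenceColumns {m : ℕ} (ϑ : Fin m → ℝ) : Matrix (Fin (m + 1)) (Fin m) ℝ :=
  Matrix.of fun j i => (Fin.cons (ϑ i) (fun k => -(1 : Matrix (Fin m) (Fin m) ℝ) k i) :
    Fin (m + 1) → ℝ) j

theorem differenceColumns_col {m : ℕ} (ϑ : Fin m → ℝ) (i : Fin m) :
    (ϑ i) • (Pi.single (0 : Fin (m+1)) (1:ℝ) : Fin (m+1) → ℝ)
      - (Pi.single (i.succ : Fin (m+1)) (1:ℝ) : Fin (m+1) → ℝ)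
      = fun j => differenceColumns ϑ j i := by
  funext j
  refine Fin.cases ?_ (fun k => ?_) j
  · simp [differenceColumns]
  · simp [differenceColumns, Pi.single_apply, Matrix.one_apply]

theorem differenceColumns_transpose_mul_self {m : ℕ} (ϑ : Fin m → ℝ) :
    (differenceColumns ϑ)ᵀ * differenceColumns ϑ = vecMulVec ϑ ϑ + 1 := by
  ext i j
  simp [Matrix.mul_apply, Fin.sum_univ_succ, differenceColumns, vecMulVec_apply,
    Matrix.one_apply, eq_comm]

theorem differenceColumns_transpose_mulVec {m : ℕ} (ϑ : Fin m → ℝ) :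
    (differenceColumns ϑ)ᵀ *ᵥ (Fin.cons 1 ϑ : Fin (m + 1) → ℝ) = 0 := by
  ext i
  simp [Matrix.mulVec, dotProduct, Fin.sum_univ_succ, differenceColumns, Matrix.one_apply]

theorem charpoly_one_sub_smul_differenceColumns {m : ℕ} (hm : 1 ≤ m) (ϑ : Fin m → ℝ) (μ : ℝ) :
    (1 - μ • (differenceColumns ϑ * (differenceColumns ϑ)ᵀ)).charpoly
      = (X - C 1) * (X - C (1 - μ)) ^ (m - 1)
          * (X - C (1 - μ * (1 + ∑ i : Fin m, (ϑ i) ^ 2))) := by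
  have hM : 1 - μ • (differenceColumns ϑ * (differenceColumns ϑ)ᵀ)
      = (-μ • differenceColumns ϑ) * (differenceColumns ϑ)ᵀ - scalar (Fin (m + 1)) (-1) := by
    simp [sub_eq_add_neg, add_comm]
  have hG : (differenceColumns ϑ)ᵀ * (-μ • differenceColumns ϑ)
      = vecMulVec (-μ • ϑ) ϑ - scalar (Fin m) μ := by
    rw [Matrix.mul_smul, differenceColumns_transpose_mul_self, smul_add, ← smul_vecMulVec,
      sub_eq_add_neg, Matrix.scalar_apply, ← Matrix.smul_one_eq_diagonal,
      neg_smul μ (1 : Matrix _ _ ℝ)]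
  rw [hM, charpoly_sub_scalar, charpoly_mul_comm_of_le _ _ (by simp), hG, charpoly_sub_scalar,
    charpoly_vecMulVec]
  obtain ⟨k, rfl⟩ := Nat.exists_eq_add_of_le' hm
  have hdot : (-μ • ϑ) ⬝ᵥ ϑ = -μ * ∑ i, ϑ i ^ 2 := by
    simp [dotProduct, Finset.mul_sum, pow_two, mul_assoc]
  rw [hdot]
  simp [smul_eq_C_mul]
  ring

/-- For `m ≥ 1`, the matrix
`M = I - μ·Σᵢ (ϑᵢ e₀ - eᵢ)(ϑᵢ e₀ - eᵢ)ᵀ` on `ℝ^{m+1}` has characteristic polynomial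
`(X - 1)(X - (1-μ))^{m-1}(X - (1 - μ(1 + Σ ϑᵢ²)))`; its eigenvalues are `1`
(with eigenvector `(1, ϑ₁, …, ϑ_m)`), `1-μ` with multiplicity `m-1`, and
`1 - μ(1 + Σ ϑᵢ²)`. -/
theorem stmt_4 {m : ℕ} (hm : 1 ≤ m) (ϑ : Fin m → ℝ) (μ : ℝ)
    (M : Matrix (Fin (m+1)) (Fin (m+1)) ℝ)
    (hM : M = 1 - μ • ∑ i : Fin m,
      Matrix.vecMulVec
        ((ϑ i) • (Pi.single (0 : Fin (m+1)) (1:ℝ) : Fin (m+1) → ℝ)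
          - (Pi.single (i.succ : Fin (m+1)) (1:ℝ) : Fin (m+1) → ℝ))
        ((ϑ i) • (Pi.single (0 : Fin (m+1)) (1:ℝ) : Fin (m+1) → ℝ)
          - (Pi.single (i.succ : Fin (m+1)) (1:ℝ) : Fin (m+1) → ℝ))) :
    M.charpoly
        = (X - C 1) * (X - C (1 - μ)) ^ (m - 1)
            * (X - C (1 - μ * (1 + ∑ i : Fin m, (ϑ i) ^ 2))) ∧
      M.mulVec (Fin.cons 1 ϑ) = (1:ℝ) • (Fin.cons 1 ϑ : Fin (m+1) → ℝ) := by
  have hsum : M = 1 - μ • (differenceColumns ϑ * (differenceColumns ϑ)ᵀ) := by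
    rw [hM]
    congr 2
    ext a b
    simp only [differenceColumns_col, Matrix.sum_apply, vecMulVec_apply, Matrix.mul_apply,
      Matrix.transpose_apply]
  rw [hsum]
  refine ⟨charpoly_one_sub_smul_differenceColumns hm ϑ μ, ?_⟩
  rw [Matrix.sub_mulVec, Matrix.smul_mulVec, ← Matrix.mulVec_mulVec,
    differenceColumns_transpose_mulVec]
  simp
end

section
/- Fix m ≥ 3 and positive reals π_0,…,π_{2m} with Π = Σ_{i=1}^{m}(π_{2i−1}+π_{2i}) ≥ 2π_0. Suppose for each i = 1,…,m that 0 ≤ q_{2i−1,2i} ≤ ((Π−π_0)/Π)·min{π_{2i−1}, π_{2i}}, and set q_{0,2i−1} = π_{2i−1}π_0/Π and q_{0,2i} = π_{2i}π_0/Π. Then P = I − D^{−1}L(q) is a stochastic matrix and its SLEM equals μ(P) = (Π−π_0)/Π. -/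
open Matrix Polynomial

section GeneralWeights

variable {n : ℕ} (pr : Fin n → ℝ) (q : Fin n → Fin n → ℝ)

lemma lap_mulVec (f : Fin n → ℝ) (v : Fin n) :
    (lap q *ᵥ f) v = ∑ k, q v k * (f v - f k) := by
  rw [mulVec, dotProduct, ← Finset.add_sum_erase _ _ (Finset.mem_univ v),
    ← Finset.add_sum_erase _ (fun k => q v k * (f v - f k)) (Finset.mem_univ v)]
  have h : ∀ k ∈ Finset.univ.erase v, lap q v k * f k = -(q v k * f k) := by
    intro k hk
    have hvk : v ≠ k := (Finset.ne_of_mem_erase hk).symm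
    simp [lap, hvk]
  rw [Finset.sum_congr rfl h]
  simp only [lap, of_apply, if_true, Finset.sum_mul, mul_sub, Finset.sum_sub_distrib,
    Finset.sum_neg_distrib]
  ring

variable {pr}

lemma transP_eq (hpr : ∀ v, 0 < pr v) :
    transP pr q = 1 - diagonal (fun v => (pr v)⁻¹) * lap q := by
  have h : (diagonal pr)⁻¹ = diagonal (fun v => (pr v)⁻¹) := by
    refine inv_eq_left_inv ?_
    rw [diagonal_mul_diagonal, ← diagonal_one]
    congr 1
    funext v
    exact inv_mul_cancel₀ (hpr v).ne'
  rw [transP, h]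

lemma transP_mulVec (hpr : ∀ v, 0 < pr v) (f : Fin n → ℝ) (v : Fin n) :
    (transP pr q *ᵥ f) v = f v - (∑ k, q v k * (f v - f k)) / pr v := by
  rw [transP_eq q hpr, sub_mulVec, one_mulVec, ← mulVec_mulVec, Pi.sub_apply,
    mulVec_diagonal, lap_mulVec, inv_mul_eq_div]

lemma transP_mulVec_one (hpr : ∀ v, 0 < pr v) : transP pr q *ᵥ 1 = 1 := by
  funext v
  simp [transP_mulVec q hpr]

lemma isStochastic_transP (hpr : ∀ v, 0 < pr v) (hq : ∀ a b, 0 ≤ q a b)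
    (hdeg : ∀ v, ∑ k, q v k ≤ pr v) : IsStochastic (transP pr q) := by
  refine ⟨fun i j => ?_, fun i => ?_⟩
  · rw [transP_eq q hpr, Matrix.sub_apply, diagonal_mul]
    rcases eq_or_ne i j with rfl | hij
    · have h : ∑ k ∈ Finset.univ.erase i, q i k ≤ pr i :=
        (Finset.sum_le_univ_sum_of_nonneg (hq i)).trans (hdeg i)
      simpa [lap, inv_mul_eq_div] using div_le_one_of_le₀ h (hpr i).le
    · simpa [lap, hij] using mul_nonneg (inv_nonneg.2 (hpr i).le) (hq i j)
  · simpa [mulVec, dotProduct] using congrFun (transP_mulVec_one q hpr) i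

/-- Reversibility of `transP` makes the weights `pr` stationary. -/
lemma sum_mul_transP_mulVec (hpr : ∀ v, 0 < pr v) (hsymm : ∀ a b, q a b = q b a)
    (f : Fin n → ℝ) : ∑ v, pr v * (transP pr q *ᵥ f) v = ∑ v, pr v * f v := by
  have h : ∀ v, pr v * (transP pr q *ᵥ f) v
      = pr v * f v - ∑ k, q v k * (f v - f k) := by
    intro v
    rw [transP_mulVec q hpr, mul_sub, mul_div_cancel₀ _ (hpr v).ne']
  have h0 : ∑ v, ∑ k, q v k * (f v - f k) = 0 := by
    simp only [mul_sub, Finset.sum_sub_distrib]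
    rw [sub_eq_zero]
    conv_rhs => rw [Finset.sum_comm]
    simp only [hsymm]
  simp only [h, Finset.sum_sub_distrib, h0, sub_zero]

/-- If the fixed vectors of `transP` are constant, then `1` is a simple root of its
characteristic polynomial. -/
lemma count_one_roots_charpoly_transP_le (hpr : ∀ v, 0 < pr v)
    (hsymm : ∀ a b, q a b = q b a)
    (hfix : ∀ f, transP pr q *ᵥ f = f → ∃ c : ℝ, f = c • 1) :
    (transP pr q).charpoly.roots.count 1 ≤ 1 := by
  set T := (transP pr q).toLin' with hT
  have hpow : ∀ (k : ℕ) (f : Fin n → ℝ), ((T - (1 : ℝ) • 1) ^ k) f = 0 → ∃ c : ℝ, f = c • 1 := by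
    intro k
    induction k with
    | zero => exact fun f hf => ⟨0, by simpa using hf⟩
    | succ k ih =>
      intro f hf
      obtain ⟨c, hc⟩ := ih ((T - (1 : ℝ) • 1) f) (by simpa [pow_succ] using hf)
      have hc' : transP pr q *ᵥ f = f + c • 1 := by
        rw [← hc]
        simp [hT]
      have hsum := sum_mul_transP_mulVec q hpr hsymm f
      rw [hc'] at hsum
      simp only [Pi.add_apply, Pi.smul_apply, Pi.one_apply, smul_eq_mul, mul_one, mul_add,
        Finset.sum_add_distrib, add_eq_left, ← Finset.sum_mul] at hsum
      rcases mul_eq_zero.1 hsum with h | h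
      · rcases isEmpty_or_nonempty (Fin n) with hn | hn
        · exact ⟨0, Subsingleton.elim _ _⟩
        · exact absurd h (Finset.sum_pos (fun v _ => hpr v) Finset.univ_nonempty).ne'
      · exact hfix f (by simpa [h] using hc')
  have hle : Module.End.maxGenEigenspace T 1 ≤ Submodule.span ℝ {(1 : Fin n → ℝ)} := by
    intro f hf
    obtain ⟨k, hk⟩ := (Module.End.mem_maxGenEigenspace T 1 f).1 hf
    obtain ⟨c, rfl⟩ := hpow k f hk
    exact Submodule.smul_mem _ _ (Submodule.mem_span_singleton_self _)
  calc (transP pr q).charpoly.roots.count 1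
      = Module.finrank ℝ (Module.End.maxGenEigenspace T 1) := by
        rw [LinearMap.finrank_maxGenEigenspace_eq, hT, charpoly_toLin', count_roots]
    _ ≤ Module.finrank ℝ (Submodule.span ℝ {(1 : Fin n → ℝ)}) := Submodule.finrank_mono hle
    _ ≤ 1 := by simpa using finrank_span_le_card (R := ℝ) ({(1 : Fin n → ℝ)} : Set (Fin n → ℝ))

end GeneralWeights

lemma mem_roots_charpoly_iff {n : ℕ} (M : Matrix (Fin n) (Fin n) ℝ) (lam : ℝ) :
    lam ∈ M.charpoly.roots ↔ ∃ f, f ≠ 0 ∧ M *ᵥ f = lam • f := by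
  rw [mem_roots M.charpoly_monic.ne_zero, ← charpoly_toLin',
    ← Module.End.hasEigenvalue_iff_isRoot_charpoly]
  constructor
  · intro h
    obtain ⟨f, hf⟩ := h.exists_hasEigenvector
    exact ⟨f, hf.2, by simpa using hf.apply_eq_smul⟩
  · rintro ⟨f, hf, h⟩
    exact Module.End.hasEigenvalue_of_hasEigenvector
      (Module.End.hasEigenvector_iff.2 ⟨Module.End.mem_eigenspace_iff.2 (by simpa using h), hf⟩)

section FriendshipGraph

variable {m : ℕ}

lemma v1_inj {i j : Fin m} : v1 i = v1 j ↔ i = j := by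
  simp only [v1, Fin.ext_iff]; omega

lemma v2_inj {i j : Fin m} : v2 i = v2 j ↔ i = j := by
  simp only [v2, Fin.ext_iff]; omega

lemma v1_ne_v2 (i j : Fin m) : v1 i ≠ v2 j := by
  simp only [v1, v2, ne_eq, Fin.ext_iff]; omega

lemma v0_ne_v1 (i : Fin m) : v0 ≠ v1 i := by
  simp only [v0, v1, ne_eq, Fin.ext_iff]; omega

lemma v0_ne_v2 (i : Fin m) : v0 ≠ v2 i := by
  simp only [v0, v2, ne_eq, Fin.ext_iff]; omega

lemma vertex_cases (v : Fin (2*m+1)) : v = v0 ∨ (∃ i, v = v1 i) ∨ ∃ i, v = v2 i := by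
  obtain ⟨v, hv⟩ := v
  rcases Nat.eq_zero_or_pos v with rfl | h
  · exact Or.inl rfl
  · rcases Nat.even_or_odd' v with ⟨k, hk | hk⟩
    · exact Or.inr (Or.inr ⟨⟨k - 1, by omega⟩, Fin.ext (by simp only [v2]; omega)⟩)
    · exact Or.inr (Or.inl ⟨⟨k, by omega⟩, Fin.ext (by simp only [v1]; omega)⟩)

lemma sum_vertices (F : Fin (2*m+1) → ℝ) :
    ∑ v, F v = F v0 + ∑ i : Fin m, (F (v1 i) + F (v2 i)) := by
  let e : Unit ⊕ (Fin m ⊕ Fin m) → Fin (2*m+1) :=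
    Sum.elim (fun _ => v0) (Sum.elim v1 v2)
  have he : Function.Bijective e := by
    constructor
    · rintro (_ | i | i) (_ | j | j) h <;>
        simp_all [e, v1_inj, v2_inj, v1_ne_v2, v0_ne_v1, v0_ne_v2, (v1_ne_v2 _ _).symm,
          (v0_ne_v1 _).symm, (v0_ne_v2 _).symm]
    · intro v
      rcases vertex_cases v with rfl | ⟨i, rfl⟩ | ⟨i, rfl⟩
      exacts [⟨Sum.inl (), rfl⟩, ⟨Sum.inr (Sum.inl i), rfl⟩, ⟨Sum.inr (Sum.inr i), rfl⟩]
  rw [← he.sum_comp]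
  simp [e, Finset.sum_add_distrib]

lemma not_isEdge_self (a : Fin (2*m+1)) : ¬ IsEdge a a := by
  rintro ⟨i, h | h | h⟩ <;> rw [Set.pair_eq_pair_iff] at h
  · rcases h with ⟨h, h'⟩ | ⟨h, h'⟩ <;> exact v0_ne_v1 i (by rw [← h, ← h'])
  · rcases h with ⟨h, h'⟩ | ⟨h, h'⟩ <;> exact v0_ne_v2 i (by rw [← h, ← h'])
  · rcases h with ⟨h, h'⟩ | ⟨h, h'⟩ <;> exact v1_ne_v2 i i (by rw [← h, ← h'])

lemma not_isEdge_v1_v1 (i j : Fin m) : ¬ IsEdge (v1 i) (v1 j) := by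
  rintro ⟨k, h⟩
  simp [Set.pair_eq_pair_iff, v1_ne_v2, (v0_ne_v1 _).symm] at h

lemma not_isEdge_v2_v2 (i j : Fin m) : ¬ IsEdge (v2 i) (v2 j) := by
  rintro ⟨k, h⟩
  simp [Set.pair_eq_pair_iff, (v1_ne_v2 _ _).symm, (v0_ne_v2 _).symm] at h

lemma not_isEdge_v1_v2 {i j : Fin m} (hij : i ≠ j) : ¬ IsEdge (v1 i) (v2 j) := by
  rintro ⟨k, h⟩
  simp only [Set.pair_eq_pair_iff, v1_ne_v2, (v1_ne_v2 _ _).symm, (v0_ne_v1 _).symm,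
    (v0_ne_v2 _).symm, v1_inj, v2_inj, false_and, and_false, or_false, false_or] at h
  exact hij (h.1.trans h.2.symm)

variable {q : Fin (2*m+1) → Fin (2*m+1) → ℝ}

lemma sum_weight_v0 (hedge : ∀ a b, ¬ IsEdge a b → q a b = 0) (g : Fin (2*m+1) → ℝ) :
    ∑ k, q v0 k * g k
      = ∑ i : Fin m, (q v0 (v1 i) * g (v1 i) + q v0 (v2 i) * g (v2 i)) := by
  rw [sum_vertices, hedge _ _ (not_isEdge_self v0), zero_mul, zero_add]

lemma sum_weight_v1 (hedge : ∀ a b, ¬ IsEdge a b → q a b = 0) (g : Fin (2*m+1) → ℝ)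
    (i : Fin m) :
    ∑ k, q (v1 i) k * g k = q (v1 i) v0 * g v0 + q (v1 i) (v2 i) * g (v2 i) := by
  rw [sum_vertices, Finset.sum_eq_single i]
  · rw [hedge _ _ (not_isEdge_v1_v1 i i), zero_mul, zero_add]
  · intro j _ hj
    rw [hedge _ _ (not_isEdge_v1_v1 i j), hedge _ _ (not_isEdge_v1_v2 hj.symm)]
    ring
  · simp

lemma sum_weight_v2 (hsymm : ∀ a b, q a b = q b a) (hedge : ∀ a b, ¬ IsEdge a b → q a b = 0)
    (g : Fin (2*m+1) → ℝ) (i : Fin m) :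
    ∑ k, q (v2 i) k * g k = q (v2 i) v0 * g v0 + q (v1 i) (v2 i) * g (v1 i) := by
  rw [sum_vertices, Finset.sum_eq_single i]
  · rw [hedge _ _ (not_isEdge_v2_v2 i i), hsymm (v2 i) (v1 i), zero_mul, add_zero]
  · intro j _ hj
    rw [hedge _ _ (not_isEdge_v2_v2 i j), hsymm, hedge _ _ (not_isEdge_v1_v2 hj)]
    ring
  · simp

end FriendshipGraph

/-- Eigenvalue bound for the two-state block carried by a single blade. -/
lemma abs_le_of_blade_eigenvector {s a b c x y lam : ℝ} (hs : 0 ≤ s) (ha : 0 < a) (hb : 0 < b)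
    (hc : 0 ≤ c) (hca : c ≤ s * a) (hcb : c ≤ s * b) (hxy : x ≠ 0 ∨ y ≠ 0)
    (h1 : s * a * x + c * (y - x) = lam * (a * x))
    (h2 : s * b * y + c * (x - y) = lam * (b * y)) : |lam| ≤ s := by
  by_cases hl : lam = s
  · rw [hl, abs_of_nonneg hs]
  have hmean : a * x + b * y = 0 := by
    have : (lam - s) * (a * x + b * y) = 0 := by linear_combination -h1 - h2
    exact (mul_eq_zero.1 this).resolve_left (sub_ne_zero.2 hl)
  have hd : x - y ≠ 0 := by
    intro hd
    obtain rfl : x = y := sub_eq_zero.1 hd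
    have : (a + b) * x = 0 := by linear_combination hmean
    have hx := (mul_eq_zero.1 this).resolve_left (add_pos ha hb).ne'
    exact hxy.elim (· hx) (· hx)
  have hlam : lam = s - (c / a + c / b) := by
    have h : (x - y) * (lam * (a * b) - (s * (a * b) - c * (a + b))) = 0 := by
      linear_combination a * h2 - b * h1
    have h' := (mul_eq_zero.1 h).resolve_left hd
    field_simp
    linear_combination h'
  have h1 : 0 ≤ c / a := div_nonneg hc ha.le
  have h2 : 0 ≤ c / b := div_nonneg hc hb.le
  have h3 : c / a ≤ s := (div_le_iff₀ ha).2 hca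
  have h4 : c / b ≤ s := (div_le_iff₀ hb).2 hcb
  rw [hlam, abs_le]
  constructor <;> linarith

/-- The weights on the friendship graph for which the center sends its whole mass to the
friends proportionally to `pr`, and the friend edges carry at most
`((PP - pr v0) / PP) * min`. -/
structure IsCenterProportional {m : ℕ} (pr : Fin (2*m+1) → ℝ) (PP : ℝ)
    (q : Fin (2*m+1) → Fin (2*m+1) → ℝ) : Prop where
  pos : ∀ v, 0 < pr v
  total : PP = ∑ i : Fin m, (pr (v1 i) + pr (v2 i))
  two_mul_le : 2 * pr v0 ≤ PP
  symm : ∀ a b, q a b = q b a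
  nonneg : ∀ a b, 0 ≤ q a b
  support : ∀ a b, ¬ IsEdge a b → q a b = 0
  friend_le : ∀ i : Fin m,
    q (v1 i) (v2 i) ≤ ((PP - pr v0) / PP) * min (pr (v1 i)) (pr (v2 i))
  center_v1 : ∀ i : Fin m, q v0 (v1 i) = pr (v1 i) * pr v0 / PP
  center_v2 : ∀ i : Fin m, q v0 (v2 i) = pr (v2 i) * pr v0 / PP

namespace IsCenterProportional

variable {m : ℕ} {pr : Fin (2*m+1) → ℝ} {PP : ℝ} {q : Fin (2*m+1) → Fin (2*m+1) → ℝ}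

lemma total_pos (h : IsCenterProportional pr PP q) : 0 < PP := by
  linarith [h.two_mul_le, h.pos v0]

lemma rate_nonneg (h : IsCenterProportional pr PP q) : 0 ≤ (PP - pr v0) / PP :=
  div_nonneg (by linarith [h.two_mul_le, h.pos v0]) h.total_pos.le

lemma rate_lt_one (h : IsCenterProportional pr PP q) : (PP - pr v0) / PP < 1 :=
  (div_lt_one h.total_pos).2 (by linarith [h.pos v0])

lemma friend_le_v1 (h : IsCenterProportional pr PP q) (i : Fin m) :
    q (v1 i) (v2 i) ≤ ((PP - pr v0) / PP) * pr (v1 i) :=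
  (h.friend_le i).trans (mul_le_mul_of_nonneg_left (min_le_left _ _) h.rate_nonneg)

lemma friend_le_v2 (h : IsCenterProportional pr PP q) (i : Fin m) :
    q (v1 i) (v2 i) ≤ ((PP - pr v0) / PP) * pr (v2 i) :=
  (h.friend_le i).trans (mul_le_mul_of_nonneg_left (min_le_right _ _) h.rate_nonneg)

lemma sum_weight_le (h : IsCenterProportional pr PP q) (v : Fin (2*m+1)) :
    ∑ k, q v k ≤ pr v := by
  have hP := h.total_pos.ne'
  rcases vertex_cases v with rfl | ⟨i, rfl⟩ | ⟨i, rfl⟩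
  · have hs := sum_weight_v0 h.support 1
    simp only [Pi.one_apply, mul_one, h.center_v1, h.center_v2, ← add_div, ← add_mul,
      ← Finset.sum_div, ← Finset.sum_mul, ← h.total] at hs
    rw [hs, mul_div_cancel_left₀ _ hP]
  · have hs := sum_weight_v1 h.support 1 i
    simp only [Pi.one_apply, mul_one, h.symm _ v0, h.center_v1] at hs
    rw [hs]
    refine (add_le_add_right (h.friend_le_v1 i) _).trans_eq ?_
    field_simp
    ring
  · have hs := sum_weight_v2 h.symm h.support 1 i
    simp only [Pi.one_apply, mul_one, h.symm _ v0, h.center_v2] at hs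
    rw [hs]
    refine (add_le_add_right (h.friend_le_v2 i) _).trans_eq ?_
    field_simp
    ring

lemma mulVec_v0 (h : IsCenterProportional pr PP q) (f : Fin (2*m+1) → ℝ) :
    PP * (transP pr q *ᵥ f) v0
      = ∑ i : Fin m, (pr (v1 i) * f (v1 i) + pr (v2 i) * f (v2 i)) := by
  have hP := h.total_pos.ne'
  have h0 := (h.pos v0).ne'
  rw [transP_mulVec q h.pos, sum_weight_v0 h.support (fun k => f v0 - f k)]
  have hs : ∑ i : Fin m, (q v0 (v1 i) * (f v0 - f (v1 i)) + q v0 (v2 i) * (f v0 - f (v2 i)))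
      = (pr v0 / PP) * (PP * f v0
        - ∑ i : Fin m, (pr (v1 i) * f (v1 i) + pr (v2 i) * f (v2 i))) := by
    nth_rw 2 [h.total]
    rw [Finset.sum_mul, ← Finset.sum_sub_distrib, Finset.mul_sum]
    refine Finset.sum_congr rfl fun i _ => ?_
    rw [h.center_v1, h.center_v2]
    ring
  rw [hs]
  field_simp
  ring

lemma mulVec_v1 (h : IsCenterProportional pr PP q) (f : Fin (2*m+1) → ℝ) (i : Fin m) :
    pr (v1 i) * (transP pr q *ᵥ f) (v1 i)
      = pr v0 / PP * pr (v1 i) * f v0 + (PP - pr v0) / PP * pr (v1 i) * f (v1 i)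
        + q (v1 i) (v2 i) * (f (v2 i) - f (v1 i)) := by
  have hP := h.total_pos.ne'
  have h1 := (h.pos (v1 i)).ne'
  rw [transP_mulVec q h.pos, sum_weight_v1 h.support (fun k => f (v1 i) - f k),
    h.symm _ v0, h.center_v1]
  field_simp
  ring

lemma mulVec_v2 (h : IsCenterProportional pr PP q) (f : Fin (2*m+1) → ℝ) (i : Fin m) :
    pr (v2 i) * (transP pr q *ᵥ f) (v2 i)
      = pr v0 / PP * pr (v2 i) * f v0 + (PP - pr v0) / PP * pr (v2 i) * f (v2 i)
        + q (v1 i) (v2 i) * (f (v1 i) - f (v2 i)) := by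
  have hP := h.total_pos.ne'
  have h2 := (h.pos (v2 i)).ne'
  rw [transP_mulVec q h.pos, sum_weight_v2 h.symm h.support (fun k => f (v2 i) - f k),
    h.symm _ v0, h.center_v2]
  field_simp
  ring

lemma abs_le_of_center_eq_zero (h : IsCenterProportional pr PP q) {f : Fin (2*m+1) → ℝ}
    {lam : ℝ} (hf : f ≠ 0) (hf0 : f v0 = 0) (hlam : transP pr q *ᵥ f = lam • f) :
    |lam| ≤ (PP - pr v0) / PP := by
  obtain ⟨i, hi⟩ : ∃ i : Fin m, f (v1 i) ≠ 0 ∨ f (v2 i) ≠ 0 := by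
    by_contra! hall
    refine hf (funext fun v => ?_)
    rcases vertex_cases v with rfl | ⟨i, rfl⟩ | ⟨i, rfl⟩
    exacts [hf0, (hall i).1, (hall i).2]
  have e1 := h.mulVec_v1 f i
  have e2 := h.mulVec_v2 f i
  simp only [hlam, Pi.smul_apply, smul_eq_mul, hf0] at e1 e2
  exact abs_le_of_blade_eigenvector h.rate_nonneg (h.pos (v1 i)) (h.pos (v2 i)) (h.nonneg _ _)
    (h.friend_le_v1 i) (h.friend_le_v2 i) hi (by linear_combination -e1)
    (by linear_combination -e2)

lemma eigenvalue_quadratic (h : IsCenterProportional pr PP q) {f : Fin (2*m+1) → ℝ}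
    {lam : ℝ} (hf0 : f v0 ≠ 0) (hlam : transP pr q *ᵥ f = lam • f) :
    (lam - 1) * (PP * lam + pr v0) = 0 := by
  have hP := h.total_pos.ne'
  have e0 := h.mulVec_v0 f
  have estat := sum_mul_transP_mulVec q h.pos h.symm f
  rw [sum_vertices, sum_vertices (fun v => pr v * f v), hlam] at estat
  simp only [hlam, Pi.smul_apply, smul_eq_mul] at e0 estat
  have hsum : ∑ i : Fin m, (pr (v1 i) * (lam * f (v1 i)) + pr (v2 i) * (lam * f (v2 i)))
      = lam * ∑ i : Fin m, (pr (v1 i) * f (v1 i) + pr (v2 i) * f (v2 i)) := by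
    rw [Finset.mul_sum]
    exact Finset.sum_congr rfl fun i _ => by ring
  rw [hsum, ← e0] at estat
  refine (mul_eq_zero.1 (?_ : f v0 * _ = 0)).resolve_left hf0
  linear_combination estat

lemma eigenvalue_eq_one_or_abs_le (h : IsCenterProportional pr PP q) {f : Fin (2*m+1) → ℝ}
    {lam : ℝ} (hf : f ≠ 0) (hlam : transP pr q *ᵥ f = lam • f) :
    lam = 1 ∨ |lam| ≤ (PP - pr v0) / PP := by
  by_cases hf0 : f v0 = 0
  · exact Or.inr (h.abs_le_of_center_eq_zero hf hf0 hlam)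
  refine (mul_eq_zero.1 (h.eigenvalue_quadratic hf0 hlam)).imp sub_eq_zero.1 fun hl => ?_
  have hP := h.total_pos
  have : lam = -(pr v0 / PP) := by
    field_simp
    linear_combination hl
  rw [this, abs_neg, abs_of_nonneg (div_nonneg (h.pos v0).le hP.le)]
  exact div_le_div_of_nonneg_right (by linarith [h.two_mul_le]) hP.le

lemma fixed_eq_const (h : IsCenterProportional pr PP q) (f : Fin (2*m+1) → ℝ)
    (hf : transP pr q *ᵥ f = f) : ∃ c : ℝ, f = c • 1 := by
  refine ⟨f v0, sub_eq_zero.1 (by_contra fun hne => ?_)⟩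
  have hle := h.abs_le_of_center_eq_zero (lam := 1) hne (by simp)
    (by rw [mulVec_sub, mulVec_smul, transP_mulVec_one q h.pos, hf, one_smul])
  rw [abs_one] at hle
  exact absurd h.rate_lt_one hle.not_gt

/-- Functions constant on two blades, balanced between them and vanishing elsewhere, are
eigenvectors for `(PP - pr v0) / PP`. -/
lemma exists_eigenvector_rate (h : IsCenterProportional pr PP q) (hm : 2 ≤ m) :
    ∃ f, f ≠ 0 ∧ transP pr q *ᵥ f = ((PP - pr v0) / PP) • f := by
  let i₀ : Fin m := ⟨0, by omega⟩
  let i₁ : Fin m := ⟨1, by omega⟩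
  have hi : i₁ ≠ i₀ := by simp [i₀, i₁]
  let w : Fin m → ℝ := fun i => pr (v1 i) + pr (v2 i)
  have hw : ∀ i, 0 < w i := fun i => add_pos (h.pos _) (h.pos _)
  let g : Fin m → ℝ := Pi.single i₀ (w i₁) - Pi.single i₁ (w i₀)
  have hg : ∑ i, w i * g i = 0 := by
    simp [g, mul_sub, Finset.sum_sub_distrib, Pi.single_apply, mul_comm]
  obtain ⟨f, hf0, hf1, hf2⟩ : ∃ f : Fin (2*m+1) → ℝ,
      f v0 = 0 ∧ (∀ i, f (v1 i) = g i) ∧ ∀ i, f (v2 i) = g i := by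
    refine ⟨fun v => ∑ i, if v = v1 i ∨ v = v2 i then g i else 0, ?_, fun i => ?_, fun i => ?_⟩
    · simp [v0_ne_v1, v0_ne_v2]
    · simp [v1_inj, v1_ne_v2]
    · simp [v2_inj, (v1_ne_v2 _ _).symm]
  refine ⟨f, fun hf => ?_, funext fun v => ?_⟩
  · have hg₀ : g i₀ = 0 := by rw [← hf1, hf, Pi.zero_apply]
    simp only [g, Pi.sub_apply, Pi.single_eq_same, Pi.single_eq_of_ne hi.symm, sub_zero] at hg₀
    exact (hw i₁).ne' hg₀
  · rcases vertex_cases v with rfl | ⟨i, rfl⟩ | ⟨i, rfl⟩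
    · refine mul_left_cancel₀ h.total_pos.ne' ?_
      rw [h.mulVec_v0]
      simpa [hf0, hf1, hf2, ← add_mul] using hg
    · refine mul_left_cancel₀ (h.pos (v1 i)).ne' ?_
      rw [h.mulVec_v1, Pi.smul_apply, smul_eq_mul, hf0, hf1, hf2]
      ring
    · refine mul_left_cancel₀ (h.pos (v2 i)).ne' ?_
      rw [h.mulVec_v2, Pi.smul_apply, smul_eq_mul, hf0, hf1, hf2]
      ring

lemma slem_transP (h : IsCenterProportional pr PP q) (hm : 2 ≤ m) :
    slem (transP pr q) = (PP - pr v0) / PP := by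
  refine IsGreatest.csSup_eq ⟨⟨_, ?_, (abs_of_nonneg h.rate_nonneg).symm⟩, ?_⟩
  · exact (Multiset.mem_erase_of_ne h.rate_lt_one.ne).2
      ((mem_roots_charpoly_iff _ _).2 (h.exists_eigenvector_rate hm))
  · rintro _ ⟨lam, hlam, rfl⟩
    obtain ⟨f, hf, hfl⟩ := (mem_roots_charpoly_iff _ _).1 (Multiset.mem_of_mem_erase hlam)
    refine (h.eigenvalue_eq_one_or_abs_le hf hfl).resolve_left ?_
    rintro rfl
    have hpos := Multiset.count_pos.2 hlam
    have hcount := count_one_roots_charpoly_transP_le q h.pos h.symm h.fixed_eq_const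
    rw [Multiset.count_erase_self] at hpos
    omega

end IsCenterProportional

/-- For `m ≥ 3` and `Π ≥ 2π₀`, with friend-edge weights in
`[0, ((Π-π₀)/Π)·min{π_{2i-1}, π_{2i}}]` and center-edge weights
`q_{0,2i-1} = π_{2i-1}π₀/Π`, `q_{0,2i} = π_{2i}π₀/Π`,
the matrix `P = I - D⁻¹L(q)` is stochastic with SLEM `(Π-π₀)/Π`. -/
theorem stmt_7 {m : ℕ} (hm : 3 ≤ m)
    (pr : Fin (2*m+1) → ℝ) (hpr : ∀ v, 0 < pr v)
    (PP : ℝ) (hPP : PP = ∑ i : Fin m, (pr (v1 i) + pr (v2 i)))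
    (hPPge : 2 * pr v0 ≤ PP)
    (q : Fin (2*m+1) → Fin (2*m+1) → ℝ)
    (hsymm : ∀ a b, q a b = q b a)
    (hqnn : ∀ a b, 0 ≤ q a b)
    (hedge : ∀ a b, ¬ IsEdge a b → q a b = 0)
    (hfr : ∀ i : Fin m,
      q (v1 i) (v2 i) ≤ ((PP - pr v0) / PP) * min (pr (v1 i)) (pr (v2 i)))
    (hc1 : ∀ i : Fin m, q v0 (v1 i) = pr (v1 i) * pr v0 / PP)
    (hc2 : ∀ i : Fin m, q v0 (v2 i) = pr (v2 i) * pr v0 / PP) :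
    IsStochastic (transP pr q) ∧ slem (transP pr q) = (PP - pr v0) / PP := by
  have h : IsCenterProportional pr PP q :=
    ⟨hpr, hPP, hPPge, hsymm, hqnn, hedge, hfr, hc1, hc2⟩
  exact ⟨isStochastic_transP q hpr hqnn h.sum_weight_le, h.slem_transP (by omega)⟩
end

section
/- Let π_0, a, b be positive reals, set ϑ_1 = √(a/π_0), ϑ_2 = √(b/π_0), μ_1 = π_0/(π_0+a), μ_2 = π_0/(π_0+b), and let e_0, e_1, e_2 be the standard basis of ℝ³. Then the 3×3 matrix M = I − μ_1(ϑ_1 e_0 − e_1)(ϑ_1 e_0 − e_1)ᵀ − μ_2(ϑ_2 e_0 − e_2)(ϑ_2 e_0 − e_2)ᵀ has eigenvalues 1, s, and −s, where s = √( a·b / ((π_0+a)(π_0+b)) ). -/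
open Matrix Polynomial

/-- For positive reals `π₀, a, b`, with `ϑ₁ = √(a/π₀)`,
`ϑ₂ = √(b/π₀)`, `μ₁ = π₀/(π₀+a)`, `μ₂ = π₀/(π₀+b)`, the 3×3 matrix
`M = I - μ₁(ϑ₁e₀-e₁)(ϑ₁e₀-e₁)ᵀ - μ₂(ϑ₂e₀-e₂)(ϑ₂e₀-e₂)ᵀ` has eigenvalues
`1, s, -s` where `s = √(ab/((π₀+a)(π₀+b)))`. -/
theorem stmt_11 (π0 a b : ℝ) (hπ0 : 0 < π0) (ha : 0 < a) (hb : 0 < b)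
    (ϑ1 ϑ2 μ1 μ2 s : ℝ)
    (hϑ1 : ϑ1 = Real.sqrt (a / π0)) (hϑ2 : ϑ2 = Real.sqrt (b / π0))
    (hμ1 : μ1 = π0 / (π0 + a)) (hμ2 : μ2 = π0 / (π0 + b))
    (hs : s = Real.sqrt (a * b / ((π0 + a) * (π0 + b))))
    (M : Matrix (Fin 3) (Fin 3) ℝ)
    (hM : M = 1
      - μ1 • Matrix.vecMulVec
          (ϑ1 • (Pi.single (0 : Fin 3) (1:ℝ) : Fin 3 → ℝ)
            - (Pi.single (1 : Fin 3) (1:ℝ) : Fin 3 → ℝ))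
          (ϑ1 • (Pi.single (0 : Fin 3) (1:ℝ) : Fin 3 → ℝ)
            - (Pi.single (1 : Fin 3) (1:ℝ) : Fin 3 → ℝ))
      - μ2 • Matrix.vecMulVec
          (ϑ2 • (Pi.single (0 : Fin 3) (1:ℝ) : Fin 3 → ℝ)
            - (Pi.single (2 : Fin 3) (1:ℝ) : Fin 3 → ℝ))
          (ϑ2 • (Pi.single (0 : Fin 3) (1:ℝ) : Fin 3 → ℝ)
            - (Pi.single (2 : Fin 3) (1:ℝ) : Fin 3 → ℝ))) :
    M.charpoly = (X - C 1) * (X - C s) * (X - C (-s)) := by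
  have h1 : μ1 * ϑ1 ^ 2 = 1 - μ1 := by
    rw [hμ1, hϑ1, Real.sq_sqrt (by positivity)]
    field_simp
    ring
  have h2 : μ2 * ϑ2 ^ 2 = 1 - μ2 := by
    rw [hμ2, hϑ2, Real.sq_sqrt (by positivity)]
    field_simp
    ring
  have hs2 : s ^ 2 = (1 - μ1) * (1 - μ2) := by
    rw [hs, hμ1, hμ2, Real.sq_sqrt (by positivity)]
    field_simp
    ring
  clear hμ1 hμ2 hϑ1 hϑ2 hs
  subst hM
  refine Polynomial.funext fun x => ?_
  rw [Matrix.eval_charpoly, Matrix.det_fin_three]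
  simp [Matrix.vecMulVec_apply]
  linear_combination (x - 1) * (x - 1 + μ2) * h1 + (x - 1) * (x - 1 + μ1) * h2 + (x - 1) * hs2
end

section
/- Let π_1, π_2, π_3 be positive reals and let q_{1,2} satisfy 0 ≤ q_{1,2} ≤ min{π_1, π_2} and q_{1,2} ≥ (π_1π_2 − π_3²)/(π_1 + π_2 + 2π_3). Set q_{1,3} = π_3(π_1 − q_{1,2})/(π_1 + π_3) and q_{2,3} = π_3(π_2 − q_{1,2})/(π_2 + π_3). Then the triangle transition matrix P = I − D^{−1}L(q) is stochastic, its eigenvalues are 1, s, and −s with s = |π_1π_2 − (π_1+π_2+π_3)·q_{1,2}| / √(π_1π_2(π_1+π_3)(π_2+π_3)), and consequently its SLEM equals μ(P) = s. -/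
open Matrix Polynomial

/-- The triangle transition matrix with the optimal weights, written with
`a = (p1 - q) / (p1 + p3)` and `b = (p2 - q) / (p2 + p3)`. -/
theorem triangle_transition_eq {p1 p2 p3 q : ℝ} (hp1 : 0 < p1) (hp2 : 0 < p2) (hp3 : 0 < p3) :
    (1 - (Matrix.diagonal ![p1, p2, p3])⁻¹ *
      !![q + p3 * (p1 - q) / (p1 + p3), -q, -(p3 * (p1 - q) / (p1 + p3));
        -q, q + p3 * (p2 - q) / (p2 + p3), -(p3 * (p2 - q) / (p2 + p3));
        -(p3 * (p1 - q) / (p1 + p3)), -(p3 * (p2 - q) / (p2 + p3)),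
          p3 * (p1 - q) / (p1 + p3) + p3 * (p2 - q) / (p2 + p3)] : Matrix (Fin 3) (Fin 3) ℝ) =
      !![(p1 - q) / (p1 + p3), q / p1, p3 * ((p1 - q) / (p1 + p3)) / p1;
        q / p2, (p2 - q) / (p2 + p3), p3 * ((p2 - q) / (p2 + p3)) / p2;
        (p1 - q) / (p1 + p3), (p2 - q) / (p2 + p3),
          1 - (p1 - q) / (p1 + p3) - (p2 - q) / (p2 + p3)] := by
  have hinv : (Matrix.diagonal ![p1, p2, p3])⁻¹ = Matrix.diagonal ![p1⁻¹, p2⁻¹, p3⁻¹] := by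
    apply Matrix.inv_eq_right_inv
    rw [Matrix.diagonal_mul_diagonal, ← Matrix.diagonal_one]
    congr 1
    ext i
    fin_cases i <;> simp [hp1.ne', hp2.ne', hp3.ne']
  rw [hinv]
  ext i j
  fin_cases i <;> fin_cases j <;>
    simp [Matrix.diagonal_mul] <;> field_simp <;> ring

/-- If the eigenvalues of a matrix are `1`, `s` and `-s` with `s ≥ 0`, then its SLEM is `s`. -/
theorem slem_eq_of_charpoly_eq {n : ℕ} {M : Matrix (Fin n) (Fin n) ℝ} {s : ℝ} (hs : 0 ≤ s)
    (h : M.charpoly = (X - C 1) * (X - C s) * (X - C (-s))) : slem M = s := by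
  have hroots : M.charpoly.roots = 1 ::ₘ s ::ₘ {-s} := by
    have hprod : M.charpoly =
        (Multiset.map (fun a => X - C a) (1 ::ₘ s ::ₘ {-s} : Multiset ℝ)).prod := by
      rw [h]
      simp [mul_assoc]
    rw [hprod, roots_multiset_prod_X_sub_C]
  have hset : {r : ℝ | ∃ lam ∈ M.charpoly.roots.erase 1, r = |lam|} = {s} := by
    ext r
    simp [hroots, abs_of_nonneg hs]
  rw [slem, hset, csSup_singleton]

/-- For the triangle (friendship graph with one blade) with given
weight `q₁₂` in the admissible range and `q₁₃ = π₃(π₁-q₁₂)/(π₁+π₃)`,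
`q₂₃ = π₃(π₂-q₁₂)/(π₂+π₃)`, the transition matrix `P = I - D⁻¹L(q)` is stochastic,
its eigenvalues are `1, s, -s` with
`s = |π₁π₂-(π₁+π₂+π₃)q₁₂| / √(π₁π₂(π₁+π₃)(π₂+π₃))`, and its SLEM equals `s`. -/
theorem stmt_14 (p1 p2 p3 q12 : ℝ) (hp1 : 0 < p1) (hp2 : 0 < p2) (hp3 : 0 < p3)
    (hq0 : 0 ≤ q12) (hqm : q12 ≤ min p1 p2)
    (hql : (p1 * p2 - p3 ^ 2) / (p1 + p2 + 2 * p3) ≤ q12)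
    (q13 q23 s : ℝ)
    (h13 : q13 = p3 * (p1 - q12) / (p1 + p3))
    (h23 : q23 = p3 * (p2 - q12) / (p2 + p3))
    (hs : s = |p1 * p2 - (p1 + p2 + p3) * q12|
        / Real.sqrt (p1 * p2 * (p1 + p3) * (p2 + p3)))
    (P : Matrix (Fin 3) (Fin 3) ℝ)
    (hP : P = 1 - (Matrix.diagonal ![p1, p2, p3])⁻¹ *
      !![q12 + q13, -q12, -q13; -q12, q12 + q23, -q23; -q13, -q23, q13 + q23]) :
    IsStochastic P ∧
      P.charpoly = (X - C 1) * (X - C s) * (X - C (-s)) ∧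
      slem P = s := by
  have hq1 : q12 ≤ p1 := hqm.trans (min_le_left _ _)
  have hq2 : q12 ≤ p2 := hqm.trans (min_le_right _ _)
  have hs0 : 0 ≤ s := by rw [hs]; positivity
  have hs2 : s ^ 2 = (p1 * p2 - (p1 + p2 + p3) * q12) ^ 2 /
      (p1 * p2 * (p1 + p3) * (p2 + p3)) := by
    rw [hs, div_pow, sq_abs, Real.sq_sqrt (by positivity)]
  subst h13 h23
  rw [triangle_transition_eq hp1 hp2 hp3] at hP
  have ha : 0 ≤ (p1 - q12) / (p1 + p3) := div_nonneg (by linarith) (by linarith)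
  have hb : 0 ≤ (p2 - q12) / (p2 + p3) := div_nonneg (by linarith) (by linarith)
  have hab : (p1 - q12) / (p1 + p3) + (p2 - q12) / (p2 + p3) ≤ 1 := by
    rw [div_le_iff₀ (by positivity)] at hql
    rw [div_add_div _ _ (by positivity) (by positivity), div_le_one (by positivity)]
    linarith
  have hchar : P.charpoly = (X - C 1) * (X - C s) * (X - C (-s)) := by
    apply Polynomial.funext
    intro x
    have hrhs : eval x ((X - C 1) * (X - C s) * (X - C (-s))) = (x - 1) * (x ^ 2 - s ^ 2) := by
      simp only [eval_mul, eval_sub, eval_X, eval_C]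
      ring
    rw [hrhs, hs2, Matrix.eval_charpoly, Matrix.det_fin_three, hP]
    simp [Matrix.scalar_apply]
    field_simp
    ring
  refine ⟨⟨?_, ?_⟩, hchar, slem_eq_of_charpoly_eq hs0 hchar⟩
  · intro i j
    rw [hP]
    fin_cases i <;> fin_cases j <;> simp <;> first | positivity | linarith
  · intro i
    rw [hP]
    fin_cases i <;> simp [Fin.sum_univ_three] <;> field_simp <;> ring
end

section
/- Let π_1, π_2, π_3 be positive reals and let q_{1,2} be a fixed weight with 0 ≤ q_{1,2} ≤ min{π_1, π_2} and q_{1,2} ≥ (π_1π_2 − π_3²)/(π_1 + π_2 + 2π_3). Then for every choice of nonnegative weights q_{1,3}, q_{2,3} making the triangle transition matrix P = I − D^{−1}L(q) stochastic, the SLEM satisfies μ(P) ≥ |π_1π_2 − (π_1+π_2+π_3)·q_{1,2}| / √(π_1π_2(π_1+π_3)(π_2+π_3)). -/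
open Matrix Polynomial

/-- If the characteristic polynomial splits as `(X - 1) (X - (t + r)) (X - (t - r))`,
then the second largest eigenvalue modulus is at least `|t| + r`. -/
lemma abs_add_le_slem {n : ℕ} (M : Matrix (Fin n) (Fin n) ℝ) (t r : ℝ)
    (hM : M.charpoly = (X - C 1) * ((X - C (t + r)) * (X - C (t - r)))) :
    |t| + r ≤ slem M := by
  have hroots : M.charpoly.roots.erase 1 = {t + r, t - r} := by
    rw [hM, roots_mul, roots_mul, roots_X_sub_C, roots_X_sub_C, roots_X_sub_C,
      Multiset.singleton_add, Multiset.erase_cons_head]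
    · rfl
    · exact mul_ne_zero (X_sub_C_ne_zero _) (X_sub_C_ne_zero _)
    · exact mul_ne_zero (X_sub_C_ne_zero _)
        (mul_ne_zero (X_sub_C_ne_zero _) (X_sub_C_ne_zero _))
  have hset : {s : ℝ | ∃ lam ∈ M.charpoly.roots.erase 1, s = |lam|} = {|t + r|, |t - r|} := by
    ext s
    simp [hroots]
  rw [slem, hset, csSup_pair]
  rcases le_total 0 t with ht | ht
  · refine le_sup_of_le_left ?_
    rw [abs_of_nonneg ht]
    exact le_abs_self _
  · refine le_sup_of_le_right ?_
    rw [abs_of_nonpos ht]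
    linarith [neg_le_abs (t - r)]

/-- The first row of a real symmetric `2 × 2` matrix with diagonal entries `A`, `E` and squared
off-diagonal entry `b2` has Euclidean norm at most the spectral norm. -/
lemma sq_add_le_sq_spectral (A E b2 : ℝ) (hb : 0 ≤ b2) :
    A ^ 2 + b2 ≤ (|(A + E) / 2| + √(((A - E) / 2) ^ 2 + b2)) ^ 2 := by
  set r := √(((A - E) / 2) ^ 2 + b2)
  have hr2 : r ^ 2 = ((A - E) / 2) ^ 2 + b2 := Real.sq_sqrt (by positivity)
  have hd : |(A - E) / 2| ≤ r := Real.abs_le_sqrt (by linarith)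
  have htd : (A + E) / 2 * ((A - E) / 2) ≤ |(A + E) / 2| * r :=
    (le_abs_self _).trans ((abs_mul _ _).trans_le
      (mul_le_mul_of_nonneg_left hd (abs_nonneg _)))
  nlinarith [sq_abs ((A + E) / 2)]

/-- For the triangle with fixed weight `q₁₂` in the admissible
range, every choice of nonnegative weights `q₁₃, q₂₃` making the transition matrix
`P = I - D⁻¹L(q)` stochastic has SLEM at least
`|π₁π₂-(π₁+π₂+π₃)q₁₂| / √(π₁π₂(π₁+π₃)(π₂+π₃))`. -/
theorem stmt_15 (p1 p2 p3 q12 : ℝ) (hp1 : 0 < p1) (hp2 : 0 < p2) (hp3 : 0 < p3)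
    (hq0 : 0 ≤ q12) (hqm : q12 ≤ min p1 p2)
    (hql : (p1 * p2 - p3 ^ 2) / (p1 + p2 + 2 * p3) ≤ q12)
    (q13 q23 : ℝ) (h13 : 0 ≤ q13) (h23 : 0 ≤ q23)
    (P : Matrix (Fin 3) (Fin 3) ℝ)
    (hP : P = 1 - (Matrix.diagonal ![p1, p2, p3])⁻¹ *
      !![q12 + q13, -q12, -q13; -q12, q12 + q23, -q23; -q13, -q23, q13 + q23])
    (hst : IsStochastic P) :
    |p1 * p2 - (p1 + p2 + p3) * q12|
        / Real.sqrt (p1 * p2 * (p1 + p3) * (p2 + p3)) ≤ slem P := by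
  set S := p1 + p2 + p3 with hS
  set A := 1 - (q12 + q23) * S / (p2 * (p1 + p3)) with hA
  set E := 1 - (q12 * p3 ^ 2 + q13 * (p1 + p3) ^ 2 + q23 * p1 ^ 2) / (p1 * p3 * (p1 + p3)) with hE
  set b2 := (q12 * p3 - q23 * p1) ^ 2 * S / (p1 * p2 * p3 * (p1 + p3) ^ 2) with hb2
  have hS0 : 0 < S := by positivity
  have hb : 0 ≤ b2 := by positivity
  have hr2 := Real.sq_sqrt (show 0 ≤ ((A - E) / 2) ^ 2 + b2 by positivity)
  have hspec := sq_add_le_sq_spectral A E b2 hb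
  set r := √(((A - E) / 2) ^ 2 + b2)
  have hchar : P.charpoly =
      (X - C 1) * ((X - C ((A + E) / 2 + r)) * (X - C ((A + E) / 2 - r))) := by
    refine Polynomial.funext fun z => ?_
    have hfac : (z - ((A + E) / 2 + r)) * (z - ((A + E) / 2 - r)) =
        (z - A) * (z - E) - b2 := by
      linear_combination -hr2
    have hinv : (Matrix.diagonal ![p1, p2, p3])⁻¹ = Matrix.diagonal ![p1⁻¹, p2⁻¹, p3⁻¹] := by
      refine Matrix.inv_eq_right_inv ?_
      rw [Matrix.diagonal_mul_diagonal, ← Matrix.diagonal_one]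
      congr 1
      ext i
      fin_cases i <;> simp [hp1.ne', hp2.ne', hp3.ne']
    rw [Matrix.eval_charpoly, hP, hinv]
    simp only [eval_mul, eval_sub, eval_X, eval_C]
    rw [hfac, Matrix.det_fin_three]
    simp [Matrix.diagonal_mul, Matrix.scalar_apply]
    rw [hA, hE, hb2, hS]
    field_simp
    ring
  refine le_trans ?_ (abs_add_le_slem P _ r hchar)
  refine (abs_le_of_sq_le_sq' ?_ (by positivity)).2
  refine le_trans ?_ hspec
  rw [div_pow, sq_abs, Real.sq_sqrt (by positivity)]
  have key : A ^ 2 + b2 = (p1 * p2 - S * q12) ^ 2 / (p1 * p2 * (p1 + p3) * (p2 + p3)) +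
      p3 * S / ((p1 + p3) * (p2 + p3)) *
        (A + (q12 * p3 - q23 * p1) / (p3 * (p1 + p3))) ^ 2 := by
    rw [hA, hb2, hS]
    field_simp
    ring
  rw [key]
  exact le_add_of_nonneg_right (by positivity)
end

section
/- Let π_1 = π_2 = p and π_3 be positive reals with π_3 ≤ p, and let q_{1,2} satisfy 0 ≤ q_{1,2} ≤ (p − π_3)/2. Set q_{1,3} = q_{2,3} = π_3/2. Then the triangle transition matrix P = I − D^{−1}L(q) is stochastic and its SLEM equals μ(P) = (2p − π_3 − 4q_{1,2})/(2p). -/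
open Matrix Polynomial

/-- The roots of a product of three monic linear factors, with multiplicity. -/
theorem roots_mul_X_sub_C_three {R : Type*} [CommRing R] [IsDomain R] (a b c : R) :
    ((X - C a) * (X - C b) * (X - C c)).roots = {a, b, c} := by
  rw [roots_mul (by simp [X_sub_C_ne_zero]), roots_mul (by simp [X_sub_C_ne_zero])]
  simp only [roots_X_sub_C]
  rfl

/-- If the characteristic polynomial has roots `1`, `a`, `b`, the SLEM is `max |a| |b|`. -/
theorem slem_eq_max {n : ℕ} {M : Matrix (Fin n) (Fin n) ℝ} {a b : ℝ}
    (h : M.charpoly.roots = {1, a, b}) : slem M = max |a| |b| := by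
  have hs : {r : ℝ | ∃ lam ∈ M.charpoly.roots.erase 1, r = |lam|} = {|a|, |b|} := by
    ext r
    simp [h]
  rw [slem, hs, csSup_pair]

/-- For the triangle with `π₁ = π₂ = p`, `π₃ ≤ p`, fixed weight
`0 ≤ q₁₂ ≤ (p-π₃)/2` and `q₁₃ = q₂₃ = π₃/2`, the transition matrix
`P = I - D⁻¹L(q)` is stochastic and its SLEM equals `(2p-π₃-4q₁₂)/(2p)`. -/
theorem stmt_16 (p p3 q12 : ℝ) (hp : 0 < p) (hp3 : 0 < p3) (hp3p : p3 ≤ p)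
    (hq0 : 0 ≤ q12) (hqu : q12 ≤ (p - p3) / 2)
    (P : Matrix (Fin 3) (Fin 3) ℝ)
    (hP : P = 1 - (Matrix.diagonal ![p, p, p3])⁻¹ *
      !![q12 + p3 / 2, -q12, -(p3 / 2);
         -q12, q12 + p3 / 2, -(p3 / 2);
         -(p3 / 2), -(p3 / 2), p3]) :
    IsStochastic P ∧ slem P = (2 * p - p3 - 4 * q12) / (2 * p) := by
  have hinv : (Matrix.diagonal ![p, p, p3])⁻¹ = Matrix.diagonal ![p⁻¹, p⁻¹, p3⁻¹] := by
    apply Matrix.inv_eq_right_inv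
    rw [Matrix.diagonal_mul_diagonal, ← Matrix.diagonal_one]
    congr 1
    funext i
    fin_cases i <;> simp [hp.ne', hp3.ne']
  have hPentries : P = !![1 - (q12 + p3 / 2) / p, q12 / p, p3 / (2 * p);
      q12 / p, 1 - (q12 + p3 / 2) / p, p3 / (2 * p);
      1 / 2, 1 / 2, 0] := by
    rw [hP, hinv]
    ext i j
    fin_cases i <;> fin_cases j <;> simp [Matrix.diagonal_mul] <;> field_simp <;> norm_num
  have hdiag : 0 ≤ 1 - (q12 + p3 / 2) / p := by
    rw [sub_nonneg, div_le_one hp]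
    linarith
  refine ⟨⟨fun i j => ?_, fun i => ?_⟩, ?_⟩
  · rw [hPentries]
    fin_cases i <;> fin_cases j <;> first | exact hdiag | (simp; try positivity)
  · rw [hPentries]
    fin_cases i <;> simp [Fin.sum_univ_three] <;> field_simp <;> ring
  · have hchar : P.charpoly = (X - C 1) * (X - C ((2 * p - p3 - 4 * q12) / (2 * p))) *
        (X - C (-(p3 / (2 * p)))) := by
      refine Polynomial.funext fun x => ?_
      rw [Matrix.eval_charpoly, hPentries, Matrix.det_fin_three]
      simp
      field_simp
      ring
    have hle : p3 / (2 * p) ≤ (2 * p - p3 - 4 * q12) / (2 * p) := by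
      gcongr
      linarith
    have hpos : 0 ≤ p3 / (2 * p) := by positivity
    rw [slem_eq_max (hchar ▸ roots_mul_X_sub_C_three _ _ _), abs_neg, abs_of_nonneg hpos,
      abs_of_nonneg (hpos.trans hle), max_eq_left hle]
end

section
/- Let π_1, π_2, π_3 be positive reals and q_{1,2} a real number, and set B_0 = 4π_1π_2 + π_3(π_1 + π_2). Define q_{1,3} = π_3·(π_1(2π_2 + π_3 + 2q_{1,2}) − 2π_2 q_{1,2})/B_0 and q_{2,3} = π_3·(π_2(2π_1 + π_3 + 2q_{1,2}) − 2π_1 q_{1,2})/B_0, so that q_{1,3} + q_{2,3} = π_3. Then the real number s = (4π_1π_2 − π_3² − 4q_{1,2}(π_1 + π_2 + π_3))/B_0 is an eigenvalue of the triangle matrix P = I − D^{−1}L(q). -/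
open Matrix Polynomial

/-- For the triangle with `B₀ = 4π₁π₂ + π₃(π₁+π₂)` and weights
`q₁₃ = π₃(π₁(2π₂+π₃+2q₁₂) - 2π₂q₁₂)/B₀`, `q₂₃ = π₃(π₂(2π₁+π₃+2q₁₂) - 2π₁q₁₂)/B₀`
(so that `q₁₃ + q₂₃ = π₃`), the real number
`s = (4π₁π₂ - π₃² - 4q₁₂(π₁+π₂+π₃))/B₀` is an eigenvalue of `P = I - D⁻¹L(q)`. -/
theorem stmt_17 (p1 p2 p3 q12 : ℝ) (hp1 : 0 < p1) (hp2 : 0 < p2) (hp3 : 0 < p3)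
    (B0 q13 q23 s : ℝ)
    (hB0 : B0 = 4 * p1 * p2 + p3 * (p1 + p2))
    (h13 : q13 = p3 * (p1 * (2 * p2 + p3 + 2 * q12) - 2 * p2 * q12) / B0)
    (h23 : q23 = p3 * (p2 * (2 * p1 + p3 + 2 * q12) - 2 * p1 * q12) / B0)
    (hs : s = (4 * p1 * p2 - p3 ^ 2 - 4 * q12 * (p1 + p2 + p3)) / B0)
    (P : Matrix (Fin 3) (Fin 3) ℝ)
    (hP : P = 1 - (Matrix.diagonal ![p1, p2, p3])⁻¹ *
      !![q12 + q13, -q12, -q13; -q12, q12 + q23, -q23; -q13, -q23, q13 + q23]) :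
    q13 + q23 = p3 ∧ ∃ v : Fin 3 → ℝ, v ≠ 0 ∧ P.mulVec v = s • v := by
  have hB : 0 < B0 := by rw [hB0]; positivity
  have hsum : q13 + q23 = p3 := by
    rw [h13, h23, ← add_div, div_eq_iff hB.ne', hB0]
    ring
  refine ⟨hsum, ?_⟩
  have hinv : (Matrix.diagonal ![p1, p2, p3])⁻¹ = Matrix.diagonal ![p1⁻¹, p2⁻¹, p3⁻¹] := by
    apply Matrix.inv_eq_right_inv
    rw [Matrix.diagonal_mul_diagonal, ← Matrix.diagonal_one]
    congr 1
    ext i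
    fin_cases i <;> simp [hp1.ne', hp2.ne', hp3.ne']
  have hdet : (P - s • (1 : Matrix (Fin 3) (Fin 3) ℝ)).det = 0 := by
    rw [hP, hinv, Matrix.det_fin_three]
    simp [Matrix.diagonal_mul]
    rw [h13, h23, hs]
    field_simp
    rw [hB0]
    ring
  obtain ⟨v, hv, hv0⟩ := Matrix.exists_mulVec_eq_zero_iff.mpr hdet
  refine ⟨v, hv, ?_⟩
  rwa [Matrix.sub_mulVec, Matrix.smul_mulVec, Matrix.one_mulVec, sub_eq_zero] at hv0
end
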